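/- arXiv:2007.03047 — 3 statements merged into one kernel-verified Lean document; each statement's English description precedes it below -/
import Mathlib

section
/- Let n be a positive natural number and let α : Fin n → ℝ be a monotone nondecreasing sequence with α k > 0 for every k. Define f : ℝ → ℝ by f(s) = ∑_{k} |s·α k − 1|, and let i be the least index j ∈ Fin n such that ∑_{k ≤ j} α k ≥ ∑_{k > j} α k. Then s⋆ = 1/(α i) is a global minimizer of f: for every s ∈ ℝ, f(1/(α i)) ≤ f(s). -/
open Finset

theorem sum_Iic_eq_sum_Iio_add {n : ℕ} (g : Fin n → ℝ) (i : Fin n) :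
    ∑ k ∈ Iic i, g k = ∑ k ∈ Iio i, g k + g i := by
  rw [← Iio_insert, sum_insert (by simp), add_comm]

theorem sum_univ_eq_sum_Iic_add_sum_Ioi {n : ℕ} (g : Fin n → ℝ) (i : Fin n) :
    ∑ k, g k = ∑ k ∈ Iic i, g k + ∑ k ∈ Ioi i, g k := by
  rw [← sum_filter_add_sum_filter_not univ (· ≤ i)]
  congr 2 <;> ext k <;> simp

theorem sum_Iio_le_of_isLeast {n : ℕ} {α : Fin n → ℝ} (hpos : ∀ k, 0 < α k) {i : Fin n}
    (hi : IsLeast {j : Fin n | ∑ k ∈ Iic j, α k ≥ ∑ k ∈ Ioi j, α k} i) :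
    ∑ k ∈ Iio i, α k ≤ ∑ k ∈ Ioi i, α k + α i := by
  by_cases h0 : i.val = 0
  · have hempty : Iio i = ∅ := by
      ext k
      simp [Fin.lt_def, h0]
    rw [hempty, sum_empty]
    exact add_nonneg (sum_nonneg fun k _ => (hpos k).le) (hpos i).le
  · by_contra! hlt
    let j : Fin n := ⟨i.val - 1, by omega⟩
    have hj : Iic j = Iio i := by
      ext k
      simp only [mem_Iic, mem_Iio, Fin.le_def, Fin.lt_def, j]
      omega
    have hsum := sum_univ_eq_sum_Iic_add_sum_Ioi α i
    rw [sum_univ_eq_sum_Iic_add_sum_Ioi α j, hj, sum_Iic_eq_sum_Iio_add] at hsum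
    have hmem : ∑ k ∈ Iic j, α k ≥ ∑ k ∈ Ioi j, α k := by
      rw [hj]
      linarith
    have hle : i.val ≤ i.val - 1 := hi.2 hmem
    omega

theorem stmt_0 (n : ℕ) (hn : 0 < n) (α : Fin n → ℝ)
    (hmono : Monotone α) (hpos : ∀ k, 0 < α k)
    (f : ℝ → ℝ) (hf : ∀ s, f s = ∑ k, |s * α k - 1|)
    (i : Fin n)
    (hi : IsLeast {j : Fin n | ∑ k ∈ Finset.Iic j, α k ≥ ∑ k ∈ Finset.Ioi j, α k} i) :
    ∀ s : ℝ, f (1 / α i) ≤ f s := by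
  intro s
  have hright : ∑ k ∈ Iic i, α k ≥ ∑ k ∈ Ioi i, α k := hi.1
  rw [sum_Iic_eq_sum_Iio_add] at hright
  have hleft := sum_Iio_le_of_isLeast hpos hi
  rw [hf, hf, sum_univ_eq_sum_Iic_add_sum_Ioi _ i, sum_univ_eq_sum_Iic_add_sum_Ioi _ i,
    sum_Iic_eq_sum_Iio_add, sum_Iic_eq_sum_Iio_add]
  set t := 1 / α i with ht
  have hti : t * α i = 1 := one_div_mul_cancel (hpos i).ne'
  have htpos : 0 < t := one_div_pos.mpr (hpos i)
  have hIio : ∑ k ∈ Iio i, |t * α k - 1| ≤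
      ∑ k ∈ Iio i, |s * α k - 1| + (s - t) * ∑ k ∈ Iio i, α k := by
    rw [mul_sum, ← sum_add_distrib]
    refine sum_le_sum fun k hk => ?_
    have hk' := mul_le_mul_of_nonneg_left (hmono (mem_Iio.mp hk).le) htpos.le
    rw [abs_of_nonpos (by linarith)]
    linarith [neg_abs_le (s * α k - 1)]
  have hIoi : ∑ k ∈ Ioi i, |t * α k - 1| ≤
      ∑ k ∈ Ioi i, |s * α k - 1| - (s - t) * ∑ k ∈ Ioi i, α k := by
    rw [mul_sum, ← sum_sub_distrib]
    refine sum_le_sum fun k hk => ?_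
    have hk' := mul_le_mul_of_nonneg_left (hmono (mem_Ioi.mp hk).le) htpos.le
    rw [abs_of_nonneg (by linarith)]
    linarith [le_abs_self (s * α k - 1)]
  have hmid : (s - t) * (∑ k ∈ Iio i, α k - ∑ k ∈ Ioi i, α k) ≤ |s * α i - 1| := by
    rw [← hti, ← sub_mul, abs_mul, abs_of_pos (hpos i)]
    calc _ ≤ |(s - t) * (∑ k ∈ Iio i, α k - ∑ k ∈ Ioi i, α k)| := le_abs_self _
      _ ≤ _ := by
        rw [abs_mul]
        gcongr
        exact abs_le.mpr ⟨by linarith, by linarith⟩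
  rw [hti, sub_self, abs_zero]
  linarith
end

section
/- Let n be a positive natural number and let α : Fin n → ℝ satisfy α k > 0 for every k. Let i be the least index j ∈ Fin n such that ∑_{k ≤ j} α k ≥ ∑_{k > j} α k. Then −∑_{k < i} α k + ∑_{k > i} α k lies in the closed interval [−α i, α i]. -/
open Finset

theorem stmt_2 (n : ℕ) (hn : 0 < n) (α : Fin n → ℝ) (hpos : ∀ k, 0 < α k)
    (i : Fin n)
    (hi : IsLeast {j : Fin n | ∑ k ∈ Finset.Iic j, α k ≥ ∑ k ∈ Finset.Ioi j, α k} i) :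
    (-∑ k ∈ Finset.Iio i, α k + ∑ k ∈ Finset.Ioi i, α k) ∈ Set.Icc (-α i) (α i) := by
  have hle : ∑ k ∈ Finset.Iic i, α k = α i + ∑ k ∈ Finset.Iio i, α k := by
    rw [← Finset.Iio_insert, Finset.sum_insert (by simp)]
  have hge : ∑ k ∈ Finset.Ici i, α k = α i + ∑ k ∈ Finset.Ioi i, α k := by
    rw [← Finset.Ioi_insert, Finset.sum_insert (by simp)]
  have hi_mem : ∑ k ∈ Finset.Iic i, α k ≥ ∑ k ∈ Finset.Ioi i, α k := hi.1
  have hlower : ∑ k ∈ Finset.Iio i, α k ≤ ∑ k ∈ Finset.Ici i, α k := by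
    by_cases h0 : i.val = 0
    · have hempty : Finset.Iio i = ∅ := by
        ext k
        simp [Fin.lt_def, h0]
      rw [hempty, Finset.sum_empty]
      exact Finset.sum_nonneg fun k _ => (hpos k).le
    · let j : Fin n := ⟨i.val - 1, by omega⟩
      have hIic : Finset.Iic j = Finset.Iio i := by
        ext k
        simp only [Finset.mem_Iic, Finset.mem_Iio, Fin.le_def, Fin.lt_def, j]
        omega
      have hIoi : Finset.Ioi j = Finset.Ici i := by
        ext k
        simp only [Finset.mem_Ioi, Finset.mem_Ici, Fin.le_def, Fin.lt_def, j]
        omega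
      by_contra! h
      have hij : i ≤ j := hi.2 (by
        rw [Set.mem_ofPred_eq, hIic, hIoi]
        exact h.le)
      simp only [Fin.le_def, j] at hij
      omega
  constructor <;> linarith
end

section
/- Let n be a positive natural number and let α : Fin n → ℝ satisfy α k > 0 for every k (with no monotonicity assumption). Then there exists an index i ∈ Fin n such that for every s ≥ 0, ∑_{k} |(α k)/(α i) − 1| ≤ ∑_{k} |s·α k − 1|; that is, the infimum over s ∈ ℝ₊ of s ↦ ∑_{k} |s·α k − 1| is attained at a point of the form 1/(α i). -/
/-- A finite family of positive weights has a weighted median among its own values. -/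
theorem exists_weighted_median {ι : Type*} [Fintype ι] [Nonempty ι] (α : ι → ℝ)
    (hpos : ∀ k, 0 < α k) :
    ∃ i, 0 ≤ ∑ k, (if α i ≤ α k then α k else -α k) ∧
      ∑ k, (if α i < α k then α k else -α k) ≤ 0 := by
  classical
  obtain ⟨m, hm⟩ := Finite.exists_min α
  let S := Finset.univ.filter fun i => 0 ≤ ∑ k, (if α i ≤ α k then α k else -α k)
  have hS : S.Nonempty := by
    refine ⟨m, Finset.mem_filter.2 ⟨Finset.mem_univ _, ?_⟩⟩
    exact Finset.sum_nonneg fun k _ => by simp [hm k, (hpos k).le]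
  obtain ⟨i, hiS, hi⟩ := S.exists_max_image α hS
  refine ⟨i, (Finset.mem_filter.1 hiS).2, ?_⟩
  by_cases hT : (Finset.univ.filter fun k => α i < α k).Nonempty
  · obtain ⟨j, hjT, hj⟩ := Finset.exists_min_image _ α hT
    have hij : α i < α j := (Finset.mem_filter.1 hjT).2
    have hiff : ∀ k, α i < α k ↔ α j ≤ α k := fun k =>
      ⟨fun h => hj k (Finset.mem_filter.2 ⟨Finset.mem_univ _, h⟩), hij.trans_le⟩
    simp only [hiff]
    by_contra! h
    exact (hi j (Finset.mem_filter.2 ⟨Finset.mem_univ _, h.le⟩)).not_gt hij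
  · refine Finset.sum_nonpos fun k _ => ?_
    have hk : ¬ α i < α k := fun h => hT ⟨k, Finset.mem_filter.2 ⟨Finset.mem_univ _, h⟩⟩
    simp [hk, (hpos k).le]

theorem stmt_6 (n : ℕ) (hn : 0 < n) (α : Fin n → ℝ) (hpos : ∀ k, 0 < α k) :
    ∃ i : Fin n, ∀ s : ℝ, 0 ≤ s →
      ∑ k, |α k / α i - 1| ≤ ∑ k, |s * α k - 1| := by
  have : Nonempty (Fin n) := ⟨⟨0, hn⟩⟩
  obtain ⟨i, hge, hlt⟩ := exists_weighted_median α hpos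
  refine ⟨i, fun s _ => ?_⟩
  have subgradient (p : Fin n → Prop) [DecidablePred p]
      (hp : ∀ k, p k → α i ≤ α k) (hnp : ∀ k, ¬ p k → α k ≤ α i)
      (h : 0 ≤ (s - 1 / α i) * ∑ k, (if p k then α k else -α k)) :
      ∑ k, |α k / α i - 1| ≤ ∑ k, |s * α k - 1| := by
    rw [Finset.mul_sum] at h
    rw [← sub_nonneg, ← Finset.sum_sub_distrib]
    refine h.trans (Finset.sum_le_sum fun k _ => ?_)
    have hdiv : 1 / α i * α k = α k / α i := by ring
    split_ifs with hk
    · have := (one_le_div (hpos i)).2 (hp k hk)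
      rw [abs_of_nonneg (sub_nonneg.2 this)]
      linarith [le_abs_self (s * α k - 1)]
    · have := (div_le_one (hpos i)).2 (hnp k hk)
      rw [abs_of_nonpos (sub_nonpos.2 this)]
      linarith [neg_le_abs (s * α k - 1)]
  rcases le_total (1 / α i) s with hs | hs
  · exact subgradient (fun k => α i ≤ α k) (fun _ h => h) (fun _ h => (not_le.1 h).le)
      (mul_nonneg (sub_nonneg.2 hs) hge)
  · exact subgradient (fun k => α i < α k) (fun _ h => h.le) (fun _ h => not_lt.1 h)
      (mul_nonneg_of_nonpos_of_nonpos (sub_nonpos.2 hs) hlt)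
end
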